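/- Case 8 of Theorem 1.2: the hypergeometric group Γ(f,g) generated by the companion matrices A and B of f(x) = x^5 + x^3 - x^2 - 1 and g(x) = x^5 + x^4 + x + 1 is an arithmetic subgroup of the integral orthogonal group O_Q(ℤ): Γ(f,g) is contained in O_Q(ℤ) (in particular Aᵀ·Q·A = Q and Bᵀ·Q·B = Q), and Γ(f,g) has finite index in O_Q(ℤ). -/

import Mathlib

open Matrix

/-- The companion matrix `A` of `f(x) = x^5 + x^3 - x^2 - 1`. -/
def matA : Matrix (Fin 5) (Fin 5) ℤ :=
  !![(0 : ℤ), 0, 0, 0, 1; 1, 0, 0, 0, 0; 0, 1, 0, 0, 1; 0, 0, 1, 0, -1; 0, 0, 0, 1, 0]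

/-- The companion matrix `B` of `g(x) = x^5 + x^4 + x + 1`. -/
def matB : Matrix (Fin 5) (Fin 5) ℤ :=
  !![(0 : ℤ), 0, 0, 0, -1; 1, 0, 0, 0, -1; 0, 1, 0, 0, 0; 0, 0, 1, 0, 0; 0, 0, 0, 1, -1]

/-- The symmetric integer matrix `Q` of the quadratic form preserved by `Γ(f,g)`. -/
def matQ : Matrix (Fin 5) (Fin 5) ℤ :=
  !![(3 : ℤ), -3, -1, 5, -5; -3, 3, -3, -1, 5; -1, -3, 3, -3, -1; 5, -1, -3, 3, -3; -5, 5, -1, -3, 3]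

/-- The integral orthogonal group `O_Q(ℤ)` of a matrix `Q`, as the subgroup of `GL₅(ℤ)`
consisting of all `M` with `Mᵀ * Q * M = Q`. -/
def orthogonalSubgroup (Q : Matrix (Fin 5) (Fin 5) ℤ) : Subgroup (GL (Fin 5) ℤ) where
  carrier := { M : GL (Fin 5) ℤ |
      (M : Matrix (Fin 5) (Fin 5) ℤ)ᵀ * Q * (M : Matrix (Fin 5) (Fin 5) ℤ) = Q }
  one_mem' := by simp
  mul_mem' := by
    intro a b ha hb
    simp only [Set.mem_setOf_eq, Units.val_mul, transpose_mul] at ha hb ⊢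
    calc ((b : Matrix (Fin 5) (Fin 5) ℤ)ᵀ * (a : Matrix (Fin 5) (Fin 5) ℤ)ᵀ) * Q *
          ((a : Matrix (Fin 5) (Fin 5) ℤ) * (b : Matrix (Fin 5) (Fin 5) ℤ))
        = (b : Matrix (Fin 5) (Fin 5) ℤ)ᵀ *
            ((a : Matrix (Fin 5) (Fin 5) ℤ)ᵀ * Q * (a : Matrix (Fin 5) (Fin 5) ℤ)) *
            (b : Matrix (Fin 5) (Fin 5) ℤ) := by
          simp only [mul_assoc]
      _ = Q := by rw [ha, hb]
  inv_mem' := by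
    intro a ha
    simp only [Set.mem_setOf_eq] at ha ⊢
    calc ((a⁻¹ : GL (Fin 5) ℤ) : Matrix (Fin 5) (Fin 5) ℤ)ᵀ * Q *
          ((a⁻¹ : GL (Fin 5) ℤ) : Matrix (Fin 5) (Fin 5) ℤ)
        = ((a⁻¹ : GL (Fin 5) ℤ) : Matrix (Fin 5) (Fin 5) ℤ)ᵀ *
            ((a : Matrix (Fin 5) (Fin 5) ℤ)ᵀ * Q * (a : Matrix (Fin 5) (Fin 5) ℤ)) *
            ((a⁻¹ : GL (Fin 5) ℤ) : Matrix (Fin 5) (Fin 5) ℤ) := by rw [ha]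
      _ = ((a : Matrix (Fin 5) (Fin 5) ℤ) *
            ((a⁻¹ : GL (Fin 5) ℤ) : Matrix (Fin 5) (Fin 5) ℤ))ᵀ * Q *
          ((a : Matrix (Fin 5) (Fin 5) ℤ) *
            ((a⁻¹ : GL (Fin 5) ℤ) : Matrix (Fin 5) (Fin 5) ℤ)) := by
          simp only [transpose_mul, mul_assoc]
      _ = Q := by rw [Units.mul_inv]; simp

abbrev M5 := Matrix (Fin 5) (Fin 5) ℤ

/-- The bilinear form `J` in the new coordinates `(p, q, a, b, c)`. -/
def bil (v w : Fin 5 → ℤ) : ℤ :=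
  v 0 * w 1 + v 1 * w 0 + 4 * v 3 * w 3 - 2 * v 2 * w 4 - 2 * v 4 * w 2

def Pres (M : M5) : Prop := ∀ v w, bil (M *ᵥ v) (M *ᵥ w) = bil v w

def Sm : M5 :=
  !![1, 1, 1, 0, 1; 1, 0, 0, 2, 1; 1, 1, 2, 2, 1; 0, -1, 0, 2, -1; -1, 1, 1, -2, -2]
def Nm : M5 :=
  !![8, 0, -4, 4, 0; -4, 8, 0, -4, 4; 2, -6, 2, 2, -2; -3, 3, 1, -1, 1; -2, -2, 2, -2, -2]
def Am : M5 :=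
  !![0, 1, 2, 0, 0; 1, 0, 0, 0, 0; -1, 0, 0, 0, -1; 1, 0, 0, 1, 1; -1, 0, -1, -2, -1]
def Bm : M5 :=
  !![2, -1, 0, 4, 4; 3, -2, -2, 4, 4; -2, 1, 1, -2, -3; 1, 0, 0, 1, 1; -2, 1, 0, -4, -3]
def Ai : M5 :=
  !![0, 1, 0, 0, 0; 1, 0, 2, 4, 2; 0, 0, -1, -2, -1; 0, 0, 1, 1, 0; 0, -1, -1, 0, 0]
def Bi : M5 :=
  !![-2, -1, -2, 0, -2; 3, 2, 4, 4, 4; -2, -2, -3, -2, -3; 1, 1, 2, 1, 1; 1, 0, 0, 0, 1]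

def s1m : M5 := !![1, 0, 0, 0, 0; 0, 1, 0, 0, 0; 0, 0, 0, 0, 1; 0, 0, 0, 1, 0; 0, 0, 1, 0, 0]
def s2m : M5 := !![1, 0, 0, 0, 0; 0, 1, 0, 0, 0; 0, 0, 1, 0, 0; 0, 0, -1, -1, 0; 0, 0, 1, 2, 1]
def Tm (n : ℤ) : M5 :=
  !![1, 0, 0, 0, 0; 0, 1, 0, 0, 0; 0, 0, 1, 0, 0; 0, 0, 2 * n, 1, 0; 0, 0, 4 * n * n, 4 * n, 1]
def Um (x y z : ℤ) : M5 :=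
  !![1, -2 * (y * y - x * z), 2 * z, -4 * y, 2 * x; 0, 1, 0, 0, 0; 0, x, 1, 0, 0;
    0, y, 0, 1, 0; 0, z, 0, 0, 1]
def Vm (x y z : ℤ) : M5 :=
  !![1, 0, 0, 0, 0; -2 * (y * y - x * z), 1, 2 * z, -4 * y, 2 * x; x, 0, 1, 0, 0;
    y, 0, 0, 1, 0; z, 0, 0, 0, 1]

/-- `M` is the matrix, in the new coordinates, of an element of `G`. -/
def InG (G : Subgroup (GL (Fin 5) ℤ)) (M : M5) : Prop :=
  (∃ γ ∈ G, (γ : M5) * Sm = Sm * M) ∧ Pres M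

theorem InG.of_eq {G : Subgroup (GL (Fin 5) ℤ)} {M N : M5} (h : InG G M) (e : M = N) :
    InG G N := e ▸ h

theorem InG.mul {G : Subgroup (GL (Fin 5) ℤ)} {M N : M5} (h : InG G M) (k : InG G N) :
    InG G (M * N) := by
  obtain ⟨⟨γ, hγ, e⟩, p⟩ := h
  obtain ⟨⟨δ, hδ, e'⟩, p'⟩ := k
  refine ⟨⟨γ * δ, G.mul_mem hγ hδ, ?_⟩, ?_⟩
  · rw [Units.val_mul, mul_assoc, e', ← mul_assoc, e, mul_assoc]
  · intro v w
    rw [← mulVec_mulVec, ← mulVec_mulVec, p, p']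

theorem InG.inv {G : Subgroup (GL (Fin 5) ℤ)} {M N : M5} (h : InG G M) (k : M * N = 1) :
    InG G N := by
  obtain ⟨⟨γ, hγ, e⟩, p⟩ := h
  refine ⟨⟨γ⁻¹, G.inv_mem hγ, ?_⟩, ?_⟩
  · calc ((γ⁻¹ : GL (Fin 5) ℤ) : M5) * Sm = (γ⁻¹ : GL (Fin 5) ℤ) * (Sm * (M * N)) := by rw [k, mul_one]
      _ = (γ⁻¹ : GL (Fin 5) ℤ) * ((γ : M5) * Sm) * N := by rw [e]; simp only [mul_assoc]
      _ = Sm * N := by rw [← mul_assoc, Units.inv_mul, one_mul]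
  · intro v w
    rw [← p, mulVec_mulVec, mulVec_mulVec, k, one_mulVec, one_mulVec]

theorem InG_Ai {G : Subgroup (GL (Fin 5) ℤ)} (hA : InG G Am) : InG G Ai :=
  hA.inv (by decide +kernel)
theorem InG_Bi {G : Subgroup (GL (Fin 5) ℤ)} (hB : InG G Bm) : InG G Bi :=
  hB.inv (by decide +kernel)
theorem InG_s1 {G : Subgroup (GL (Fin 5) ℤ)} (hA : InG G Am) (hB : InG G Bm) : InG G s1m := by
  have hAi := InG_Ai hA
  have hBi := InG_Bi hB
  have k0 : InG G !![1, 2, 2, 0, 2; 2, -1, 0, 4, 2; -2, 1, 0, -4, -3; 1, -1, 0, 3, 1; -1, 0, -1, -2, -1] :=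
    ((((hA.mul hA).mul hA).mul hA)).of_eq (by decide +kernel)
  have k1 : InG G !![-1, 2, -2, -4, 0; 2, 1, 4, 4, 2; -1, -1, -3, -2, -1; 1, 0, 2, 3, 1; 0, -1, 0, 0, -1] :=
    ((((hBi.mul hAi).mul hAi).mul hAi)).of_eq (by decide +kernel)
  exact ((k0.mul k1)).of_eq (by decide +kernel)
theorem InG_s2 {G : Subgroup (GL (Fin 5) ℤ)} (hA : InG G Am) (hB : InG G Bm) : InG G s2m := by
  have hAi := InG_Ai hA
  have hBi := InG_Bi hB
  have k0 : InG G !![-1, 0, 0, 0, -2; 0, 1, 2, 0, 0; 1, -1, -1, 2, 1; -1, 0, 0, -1, -1; 1, 0, 0, 0, 1] :=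
    ((((hA.mul hA).mul hA).mul hBi)).of_eq (by decide +kernel)
  have k1 : InG G !![1, 0, 2, 4, 2; 0, -1, 0, 0, -2; 0, 1, 0, 0, 1; 0, 0, 0, -1, -1; -1, 0, -1, -2, -1] :=
    ((hAi.mul hAi)).of_eq (by decide +kernel)
  exact ((k0.mul k1)).of_eq (by decide +kernel)
theorem InG_T1 {G : Subgroup (GL (Fin 5) ℤ)} (hA : InG G Am) (hB : InG G Bm) : InG G (Tm 1) := by
  have hAi := InG_Ai hA
  have hBi := InG_Bi hB
  have k0 : InG G !![-1, 0, 0, 0, -2; 0, 1, 2, 0, 0; 1, -1, -1, 2, 1; -1, 0, 0, -1, -1; 1, 0, 0, 0, 1] :=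
    ((((hA.mul hA).mul hA).mul hBi)).of_eq (by decide +kernel)
  have k1 : InG G !![3, -2, -2, 4, 4; -2, 3, 2, -4, -4; 2, -2, -1, 4, 4; -1, 1, 1, -1, -2; -1, 1, 1, -2, -1] :=
    ((((hAi.mul hAi).mul hA).mul hB)).of_eq (by decide +kernel)
  have k2 : InG G !![1, 2, 2, 0, 2; -2, -3, -2, 0, -6; 0, 2, 1, -2, 1; -1, -1, -1, -1, -2; -1, -1, -1, 0, -2] :=
    ((((hA.mul hB).mul hB).mul hA)).of_eq (by decide +kernel)
  have k3 : InG G !![-7, 2, 2, -8, -6; 2, 1, 2, 0, 2; -1, -1, -2, 0, -1; 2, 0, 0, 1, 2; 3, -1, -1, 4, 2] :=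
    ((((hBi.mul hBi).mul hBi).mul hAi)).of_eq (by decide +kernel)
  have k4 : InG G !![-1, 0, 2, 0, 0; 2, -1, 0, 4, 0; -2, 1, 0, -4, -1; 1, 0, 0, 1, 0; 0, 0, -1, 0, 0] :=
    ((hBi.mul hAi)).of_eq (by decide +kernel)
  exact (((((k0.mul k1).mul k2).mul k3).mul k4)).of_eq (by decide +kernel)
theorem InG_U1 {G : Subgroup (GL (Fin 5) ℤ)} (hA : InG G Am) (hB : InG G Bm) : InG G (Um 0 1 (-1)) := by
  have hAi := InG_Ai hA
  have hBi := InG_Bi hB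
  have k0 : InG G !![1, 2, 2, 0, 2; 0, -3, -4, 0, 0; 0, 1, 1, 0, 0; 0, -2, -2, 1, 0; -2, 1, 0, -4, -3] :=
    ((((hA.mul hB).mul hA).mul hB)).of_eq (by decide +kernel)
  have k1 : InG G !![-3, 0, -2, -4, -2; -2, 1, 0, -4, 0; 2, -1, 0, 4, 1; -1, 0, 0, -1, -1; 2, 0, 1, 2, 1] :=
    ((((hB.mul hA).mul hA).mul hBi)).of_eq (by decide +kernel)
  have k2 : InG G !![-5, 0, -4, -8, -4; 2, 3, 6, 0, 2; -1, -2, -4, 0, -1; 2, 2, 4, 1, 2; 1, -2, -1, 4, 0] :=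
    ((((hBi.mul hAi).mul hBi).mul hBi)).of_eq (by decide +kernel)
  have k3 : InG G !![3, 2, 4, 4, 4; 0, -1, 0, 0, -2; -1, 0, -1, 0, 0; -1, -1, -1, -1, -2; -1, 0, -1, -2, -1] :=
    ((hAi.mul hBi)).of_eq (by decide +kernel)
  exact ((((k0.mul k1).mul k2).mul k3)).of_eq (by decide +kernel)
theorem InG_neg {G : Subgroup (GL (Fin 5) ℤ)} (hA : InG G Am) (hB : InG G Bm) : InG G !![-1, 2, 2, 4, 0; 0, -1, 0, 0, 0; 0, 0, -1, 0, 0; 0, -1, -1, -1, 0; 0, -1, -1, -2, -1] := by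
  have hAi := InG_Ai hA
  have hBi := InG_Bi hB
  exact ((((hBi.mul hBi).mul hAi).mul hBi)).of_eq (by decide +kernel)
theorem InG_base0 {G : Subgroup (GL (Fin 5) ℤ)} (hA : InG G Am) (hB : InG G Bm) : InG G !![1, -2, 0, 4, 0; 0, 1, 0, 0, -2; -1, 0, 1, -2, 1; 0, 1, 0, -1, -1; 0, 0, 0, 0, 1] := by
  have hAi := InG_Ai hA
  have hBi := InG_Bi hB
  have k0 : InG G !![-1, 2, 0, -4, -2; 2, 1, 2, 4, 4; -1, -1, -1, -2, -3; 1, 0, 1, 3, 2; 0, -1, -1, 0, 0] :=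
    ((((hAi.mul hAi).mul hAi).mul hAi)).of_eq (by decide +kernel)
  have k1 : InG G !![-1, 0, 2, 0, 0; 2, -1, 0, 4, 0; -2, 1, 0, -4, -1; 1, 0, 0, 1, 0; 0, 0, -1, 0, 0] :=
    ((hBi.mul hAi)).of_eq (by decide +kernel)
  exact ((k0.mul k1)).of_eq (by decide +kernel)
theorem InG_base1 {G : Subgroup (GL (Fin 5) ℤ)} (hA : InG G Am) (hB : InG G Bm) : InG G !![1, 0, 2, 4, 2; 0, -1, 0, 0, -2; 0, 1, 0, 0, 1; 0, 0, 0, -1, -1; -1, 0, -1, -2, -1] := by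
  have hAi := InG_Ai hA
  have hBi := InG_Bi hB
  exact ((hAi.mul hAi)).of_eq (by decide +kernel)
theorem InG_base2 {G : Subgroup (GL (Fin 5) ℤ)} (hA : InG G Am) (hB : InG G Bm) : InG G !![-1, 0, -2, 0, 0; 0, 1, 0, 0, 2; 0, -1, 0, 0, -1; 0, 0, 0, 1, 0; 1, 0, 1, 0, 0] := by
  have hAi := InG_Ai hA
  have hBi := InG_Bi hB
  have k0 : InG G !![-1, 2, 2, -4, 0; 0, -1, 0, 0, 0; 0, 0, -1, 0, 0; 0, 1, 1, -1, 0; 0, -1, -1, 2, -1] :=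
    ((((hB.mul hA).mul hB).mul hB)).of_eq (by decide +kernel)
  have k1 : InG G !![1, 0, 2, 4, 2; 0, -1, 0, 0, -2; 0, 1, 0, 0, 1; 0, 0, 0, -1, -1; -1, 0, -1, -2, -1] :=
    ((hAi.mul hAi)).of_eq (by decide +kernel)
  exact ((k0.mul k1)).of_eq (by decide +kernel)
theorem InG_base3 {G : Subgroup (GL (Fin 5) ℤ)} (hA : InG G Am) (hB : InG G Bm) : InG G !![-1, 0, 0, 0, -2; 0, -1, 0, 0, 2; 0, 0, 0, 0, -1; 0, 0, 0, -1, 1; 1, -1, -1, 2, 1] := by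
  have hAi := InG_Ai hA
  have hBi := InG_Bi hB
  have k0 : InG G !![1, 2, 2, 0, 2; 0, -3, -4, 0, 0; 0, 1, 1, 0, 0; 0, -2, -2, 1, 0; -2, 1, 0, -4, -3] :=
    ((((hA.mul hB).mul hA).mul hB)).of_eq (by decide +kernel)
  have k1 : InG G !![1, 0, 2, 4, 2; 0, -1, 0, 0, -2; 0, 1, 0, 0, 1; 0, 0, 0, -1, -1; -1, 0, -1, -2, -1] :=
    ((hAi.mul hAi)).of_eq (by decide +kernel)
  exact ((k0.mul k1)).of_eq (by decide +kernel)

theorem U_add (x y z x' y' z' : ℤ) : Um x y z * Um x' y' z' = Um (x + x') (y + y') (z + z') := by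
  ext i j
  fin_cases i <;> fin_cases j <;> simp [Um, Matrix.mul_apply, Fin.sum_univ_succ] <;> ring
theorem V_add (x y z x' y' z' : ℤ) : Vm x y z * Vm x' y' z' = Vm (x + x') (y + y') (z + z') := by
  ext i j
  fin_cases i <;> fin_cases j <;> simp [Vm, Matrix.mul_apply, Fin.sum_univ_succ] <;> ring
theorem T_add (n m : ℤ) : Tm n * Tm m = Tm (n + m) := by
  ext i j
  fin_cases i <;> fin_cases j <;> simp [Tm, Matrix.mul_apply, Fin.sum_univ_succ] <;> ring
theorem U_zero : Um 0 0 0 = 1 := by decide +kernel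
theorem V_zero : Vm 0 0 0 = 1 := by decide +kernel
theorem T_zero : Tm 0 = 1 := by decide +kernel

theorem InG_one {G : Subgroup (GL (Fin 5) ℤ)} : InG G 1 :=
  ⟨⟨1, G.one_mem, by simp⟩, fun v w => by simp⟩

def Usub (G : Subgroup (GL (Fin 5) ℤ)) : AddSubgroup (ℤ × ℤ × ℤ) where
  carrier := {u | InG G (Um u.1 u.2.1 u.2.2)}
  zero_mem' := InG_one.of_eq U_zero.symm
  add_mem' := fun {u v} hu hv => (InG.mul hu hv).of_eq (U_add _ _ _ _ _ _)
  neg_mem' := fun {u} hu => InG.inv hu (by simp [U_add, U_zero])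

def Vsub (G : Subgroup (GL (Fin 5) ℤ)) : AddSubgroup (ℤ × ℤ × ℤ) where
  carrier := {u | InG G (Vm u.1 u.2.1 u.2.2)}
  zero_mem' := InG_one.of_eq V_zero.symm
  add_mem' := fun {u v} hu hv => (InG.mul hu hv).of_eq (V_add _ _ _ _ _ _)
  neg_mem' := fun {u} hu => InG.inv hu (by simp [V_add, V_zero])

def Tsub (G : Subgroup (GL (Fin 5) ℤ)) : AddSubgroup ℤ where
  carrier := {n | InG G (Tm n)}
  zero_mem' := InG_one.of_eq T_zero.symm
  add_mem' := fun {u v} hu hv => (InG.mul hu hv).of_eq (T_add _ _)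
  neg_mem' := fun {u} hu => InG.inv hu (by simp [T_add, T_zero])

theorem InG_T {G : Subgroup (GL (Fin 5) ℤ)} (hA : InG G Am) (hB : InG G Bm) (n : ℤ) :
    InG G (Tm n) := by
  have h : (1 : ℤ) ∈ Tsub G := InG_T1 hA hB
  have h2 : n ∈ Tsub G := by simpa using (Tsub G).zsmul_mem h n
  exact h2

theorem InG_U2 {G : Subgroup (GL (Fin 5) ℤ)} (hA : InG G Am) (hB : InG G Bm) :
    InG G (Um (-1) 1 0) :=
  (((InG_s1 hA hB).mul (InG_U1 hA hB)).mul (InG_s1 hA hB)).of_eq (by decide +kernel)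

theorem InG_U3 {G : Subgroup (GL (Fin 5) ℤ)} (hA : InG G Am) (hB : InG G Bm) :
    InG G (Um 0 0 (-2)) := by
  have h : InG G (Um (-2) 0 0) :=
    ((((InG_T hA hB 1).mul (InG_U2 hA hB)).mul (InG_T hA hB (-1))).mul (InG_U2 hA hB)).of_eq
      (by decide +kernel)
  exact (((InG_s1 hA hB).mul h).mul (InG_s1 hA hB)).of_eq (by decide +kernel)

theorem InG_U {G : Subgroup (GL (Fin 5) ℤ)} (hA : InG G Am) (hB : InG G Bm) (x y z m : ℤ)
    (h : x + y + z = 2 * m) : InG G (Um x y z) := by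
  have h1 : ((0, 1, -1) : ℤ × ℤ × ℤ) ∈ Usub G := InG_U1 hA hB
  have h2 : ((-1, 1, 0) : ℤ × ℤ × ℤ) ∈ Usub G := InG_U2 hA hB
  have h3 : ((0, 0, -2) : ℤ × ℤ × ℤ) ∈ Usub G := InG_U3 hA hB
  have := (Usub G).add_mem ((Usub G).add_mem ((Usub G).zsmul_mem h1 (x + y))
    ((Usub G).zsmul_mem h2 (-x))) ((Usub G).zsmul_mem h3 (-m))
  have e : (x + y) • ((0, 1, -1) : ℤ × ℤ × ℤ) + (-x) • ((-1, 1, 0) : ℤ × ℤ × ℤ)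
      + (-m) • ((0, 0, -2) : ℤ × ℤ × ℤ) = (x, y, z) := by
    ext <;> simp <;> lia
  rw [e] at this
  exact this

theorem InG_V {G : Subgroup (GL (Fin 5) ℤ)} (hA : InG G Am) (hB : InG G Bm) (x y z m : ℤ)
    (h : x + y + z = 2 * m) : InG G (Vm x y z) := by
  have hAi := InG_Ai hA
  have h1 : ((-1, 1, 0) : ℤ × ℤ × ℤ) ∈ Vsub G :=
    ((hAi.mul (InG_U1 hA hB)).mul hA).of_eq (N := Vm (-1) 1 0) (by decide +kernel)
  have h2 : ((-1, 0, 1) : ℤ × ℤ × ℤ) ∈ Vsub G :=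
    ((hAi.mul (InG_U2 hA hB)).mul hA).of_eq (N := Vm (-1) 0 1) (by decide +kernel)
  have h3 : ((2, 0, 0) : ℤ × ℤ × ℤ) ∈ Vsub G :=
    ((hAi.mul (InG_U3 hA hB)).mul hA).of_eq (N := Vm 2 0 0) (by decide +kernel)
  have := (Vsub G).add_mem ((Vsub G).add_mem ((Vsub G).zsmul_mem h1 y)
    ((Vsub G).zsmul_mem h2 z)) ((Vsub G).zsmul_mem h3 m)
  have e : y • ((-1, 1, 0) : ℤ × ℤ × ℤ) + z • ((-1, 0, 1) : ℤ × ℤ × ℤ)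
      + m • ((2, 0, 0) : ℤ × ℤ × ℤ) = (x, y, z) := by
    ext <;> simp <;> lia
  rw [e] at this
  exact this



theorem near (q a : ℤ) (hq : q ≠ 0) : ∃ n : ℤ, 2 * |a + n * q| ≤ |q| := by
  have h0 := Int.emod_nonneg a hq
  have h1 := Int.emod_lt_abs a hq
  have h2 := Int.emod_add_mul_ediv a q
  by_cases h : 2 * (a % q) ≤ |q|
  · refine ⟨-(a / q), ?_⟩
    have : a + -(a / q) * q = a % q := by linear_combination -h2
    rw [this, abs_of_nonneg h0]; exact h
  · rcases lt_or_gt_of_ne hq with hn | hp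
    · refine ⟨-(a / q) + 1, ?_⟩
      have : a + (-(a / q) + 1) * q = a % q + q := by linear_combination -h2
      rw [abs_of_neg hn] at *
      rw [this, abs_of_nonpos (by linarith)]; linarith
    · refine ⟨-(a / q) - 1, ?_⟩
      have : a + (-(a / q) - 1) * q = a % q - q := by linear_combination -h2
      rw [abs_of_pos hp] at *
      rw [this, abs_of_nonpos (by linarith)]; linarith

theorem bnd (q a b c : ℤ) (hb : 2 * |b| ≤ |q|) (hac : 4 * (|a| * |c|) ≤ q ^ 2) :
    |2 * (a * c - b ^ 2)| ≤ q ^ 2 := by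
  have h1 : |a * c| = |a| * |c| := abs_mul a c
  have h2 := abs_le.1 (le_refl |a * c|)
  have h3 : 4 * b ^ 2 ≤ q ^ 2 := by
    rw [← sq_abs b, ← sq_abs q]
    nlinarith [abs_nonneg b, abs_nonneg q]
  rw [abs_le]
  constructor <;> nlinarith [sq_nonneg b]

theorem shift (q a : ℤ) (h : 2 * |a| ≤ |q|) : ∃ ε : ℤ, (ε = 1 ∨ ε = -1) ∧ |a + ε * q| = |q| - |a| := by
  rcases abs_cases q with ⟨h1, h2⟩ | ⟨h1, h2⟩ <;> rcases abs_cases a with ⟨h3, h4⟩ | ⟨h3, h4⟩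
  · exact ⟨-1, Or.inr rfl, by rw [abs_of_nonpos] <;> linarith⟩
  · exact ⟨1, Or.inl rfl, by rw [abs_of_nonneg] <;> linarith⟩
  · exact ⟨1, Or.inl rfl, by rw [abs_of_nonpos] <;> linarith⟩
  · exact ⟨-1, Or.inr rfl, by rw [abs_of_nonneg] <;> linarith⟩

theorem keyred (q a b c : ℤ) (hq : q ≠ 0) : ∃ x y z m : ℤ, x + y + z = 2 * m ∧
    |2 * ((a + x * q) * (c + z * q) - (b + y * q) ^ 2)| ≤ q ^ 2 := by
  obtain ⟨x, hx⟩ := near q a hq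
  obtain ⟨y, hy⟩ := near q b hq
  obtain ⟨z, hz⟩ := near q c hq
  have hqq : |q| * |q| = q ^ 2 := by rw [← sq_abs q]; ring
  rcases Int.even_or_odd' (x + y + z) with ⟨m, hm | hm⟩
  · refine ⟨x, y, z, m, hm, bnd q _ _ _ hy ?_⟩
    nlinarith [abs_nonneg (a + x * q), abs_nonneg (c + z * q)]
  · rcases le_total |c + z * q| |a + x * q| with hl | hl
    · obtain ⟨ε, he, hs⟩ := shift q _ hx
      have h2 : a + (x + ε) * q = a + x * q + ε * q := by ring
      have hp : ∃ m', x + ε + y + z = 2 * m' := by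
        rcases he with rfl | rfl
        · exact ⟨m + 1, by linarith⟩
        · exact ⟨m, by linarith⟩
      obtain ⟨m', hm'⟩ := hp
      refine ⟨x + ε, y, z, m', hm', bnd q _ _ _ hy ?_⟩
      rw [h2, hs]
      nlinarith [abs_nonneg (c + z * q), sq_nonneg (|q| - 2 * |c + z * q|)]
    · obtain ⟨ε, he, hs⟩ := shift q _ hz
      have h2 : c + (z + ε) * q = c + z * q + ε * q := by ring
      have hp : ∃ m', x + y + (z + ε) = 2 * m' := by
        rcases he with rfl | rfl
        · exact ⟨m + 1, by linarith⟩
        · exact ⟨m, by linarith⟩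
      obtain ⟨m', hm'⟩ := hp
      refine ⟨x, y, z + ε, m', hm', bnd q _ _ _ hy ?_⟩
      rw [h2, hs]
      nlinarith [abs_nonneg (a + x * q), sq_nonneg (|q| - 2 * |a + x * q|)]

theorem U_vec (x y z p q a b c : ℤ) : Um x y z *ᵥ ![p, q, a, b, c] =
    ![p - 2 * (y * y - x * z) * q + 2 * z * a - 4 * y * b + 2 * x * c, q,
      a + x * q, b + y * q, c + z * q] := by
  ext i
  fin_cases i <;> simp [Um, Matrix.mulVec, dotProduct, Fin.sum_univ_succ] <;> ring

theorem V_vec (x y z p q a b c : ℤ) : Vm x y z *ᵥ ![p, q, a, b, c] =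
    ![p, q - 2 * (y * y - x * z) * p + 2 * z * a - 4 * y * b + 2 * x * c,
      a + x * p, b + y * p, c + z * p] := by
  ext i
  fin_cases i <;> simp [Vm, Matrix.mulVec, dotProduct, Fin.sum_univ_succ] <;> ring

theorem T_vec (n p q a b c : ℤ) : Tm n *ᵥ ![p, q, a, b, c] =
    ![p, q, a, b + 2 * n * a, c + 4 * n * b + 4 * n * n * a] := by
  ext i
  fin_cases i <;> simp [Tm, Matrix.mulVec, dotProduct, Fin.sum_univ_succ] <;> ring

theorem s1_vec (p q a b c : ℤ) : s1m *ᵥ ![p, q, a, b, c] = ![p, q, c, b, a] := by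
  ext i
  fin_cases i <;> simp [s1m, Matrix.mulVec, dotProduct, Fin.sum_univ_succ]

theorem s2_vec (p q a b c : ℤ) : s2m *ᵥ ![p, q, a, b, c] =
    ![p, q, a, -a - b, a + 2 * b + c] := by
  ext i
  fin_cases i <;> simp [s2m, Matrix.mulVec, dotProduct, Fin.sum_univ_succ] <;> ring

theorem A_vec (p q a b c : ℤ) : Am *ᵥ ![p, q, a, b, c] =
    ![q + 2 * a, p, -p - c, p + b + c, -p - a - 2 * b - c] := by
  ext i
  fin_cases i <;> simp [Am, Matrix.mulVec, dotProduct, Fin.sum_univ_succ] <;> ring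

theorem bil_vec (p q a b c p' q' a' b' c' : ℤ) : bil ![p, q, a, b, c] ![p', q', a', b', c'] =
    p * q' + q * p' + 4 * b * b' - 2 * a * c' - 2 * c * a' := by
  simp [bil]

theorem vec5 (v : Fin 5 → ℤ) : v = ![v 0, v 1, v 2, v 3, v 4] := by
  ext i; fin_cases i <;> rfl

def Good (v : Fin 5 → ℤ) : Prop := bil v v = 0 ∧ ∃ w, bil v w = 1

theorem Good.act {G : Subgroup (GL (Fin 5) ℤ)} {M : M5} (h : InG G M) {v : Fin 5 → ℤ}
    (hv : Good v) : Good (M *ᵥ v) := by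
  obtain ⟨h1, w, hw⟩ := hv
  exact ⟨by rw [h.2, h1], M *ᵥ w, by rw [h.2, hw]⟩

theorem Good.iff {p q a b c : ℤ} (h : Good ![p, q, a, b, c]) : p * q = 2 * (a * c - b ^ 2) ∧
    ∃ p' q' a' b' c', p * q' + q * p' + 4 * b * b' - 2 * a * c' - 2 * c * a' = 1 := by
  obtain ⟨h1, w, hw⟩ := h
  rw [vec5 w] at hw
  rw [bil_vec] at h1 hw
  exact ⟨by linarith, _, _, _, _, _, hw⟩

def Rl (G : Subgroup (GL (Fin 5) ℤ)) (v w : Fin 5 → ℤ) : Prop := ∃ M, InG G M ∧ M *ᵥ v = w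

theorem Rl.trans {G : Subgroup (GL (Fin 5) ℤ)} {u v w : Fin 5 → ℤ} (h : Rl G u v)
    (k : Rl G v w) : Rl G u w := by
  obtain ⟨M, hM, rfl⟩ := h
  obtain ⟨N, hN, rfl⟩ := k
  exact ⟨N * M, hN.mul hM, by rw [mulVec_mulVec]⟩

theorem Rl.good {G : Subgroup (GL (Fin 5) ℤ)} {u v : Fin 5 → ℤ} (h : Rl G u v)
    (k : Good u) : Good v := by
  obtain ⟨M, hM, rfl⟩ := h
  exact k.act hM

theorem Rl.refl {G : Subgroup (GL (Fin 5) ℤ)} (u : Fin 5 → ℤ) : Rl G u u :=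
  ⟨1, InG_one, by simp⟩

/-- First reduction: reach `q = 0`. -/
theorem stepA {G : Subgroup (GL (Fin 5) ℤ)} (hA : InG G Am) (hB : InG G Bm) :
    ∀ (n : ℕ) (p q a b c : ℤ), p.natAbs + q.natAbs ≤ n → Good ![p, q, a, b, c] →
      ∃ p' a' b' c', Rl G ![p, q, a, b, c] ![p', 0, a', b', c'] := by
  intro n
  induction n with
  | zero =>
    intro p q a b c hn hg
    have hq : q = 0 := by lia
    subst hq
    exact ⟨p, a, b, c, Rl.refl _⟩
  | succ n ih =>
    intro p q a b c hn hg
    obtain ⟨h1, p', q', a', b', c', h2⟩ := hg.iff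
    by_cases hq : q = 0
    · subst hq
      exact ⟨p, a, b, c, Rl.refl _⟩
    by_cases hp : p = 0
    · subst hp
      exact ⟨_, _, _, _, Am, hA, A_vec _ _ _ _ _⟩
    have hne : p.natAbs ≠ q.natAbs := by
      intro he
      have hpar : p % 2 = q % 2 := by lia
      rcases Int.even_or_odd p with hpe | hpo
      · have hqe : Even q := by rw [Int.even_iff] at *; lia
        obtain ⟨r, rfl⟩ := hpe
        obtain ⟨s, rfl⟩ := hqe
        have : 2 * (r * q' + s * p' + 2 * b * b' - a * c' - c * a') = 1 := by linarith
        lia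
      · have hqo : Odd q := by rw [Int.odd_iff] at *; lia
        have := hpo.mul hqo
        rw [h1] at this
        exact absurd this (by simp)
    rcases lt_or_gt_of_ne hne with hlt | hlt
    · obtain ⟨x, y, z, m, hm, hb⟩ := keyred p a b c hp
      have hR : Rl G ![p, q, a, b, c] _ := ⟨_, InG_V hA hB x y z m hm, V_vec _ _ _ _ _ _ _ _⟩
      have hg' := hR.good hg
      obtain ⟨h3, -⟩ := hg'.iff
      rw [← h3, abs_mul, ← sq_abs p] at hb
      have hp' : 0 < |p| := abs_pos.2 hp
      have hle := le_of_mul_le_mul_left (hb.trans (le_of_eq (sq |p|))) hp'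
      simp only [Int.abs_eq_natAbs] at hle
      obtain ⟨p', a', b', c', hf⟩ := ih _ _ _ _ _ (by lia) hg'
      exact ⟨p', a', b', c', hR.trans hf⟩
    · obtain ⟨x, y, z, m, hm, hb⟩ := keyred q a b c hq
      have hR : Rl G ![p, q, a, b, c] _ := ⟨_, InG_U hA hB x y z m hm, U_vec _ _ _ _ _ _ _ _⟩
      have hg' := hR.good hg
      obtain ⟨h3, -⟩ := hg'.iff
      rw [← h3, abs_mul, ← sq_abs q] at hb
      have hp' : 0 < |q| := abs_pos.2 hq
      have hle := le_of_mul_le_mul_right (hb.trans (le_of_eq (sq |q|))) hp'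
      simp only [Int.abs_eq_natAbs] at hle
      obtain ⟨p', a', b', c', hf⟩ := ih _ _ _ _ _ (by lia) hg'
      exact ⟨p', a', b', c', hR.trans hf⟩

/-- Second reduction: with `q = 0`, reach `b = c = 0` by elements of the Levi part. -/
theorem stepB {G : Subgroup (GL (Fin 5) ℤ)} (hA : InG G Am) (hB : InG G Bm) :
    ∀ (n : ℕ) (p a b c : ℤ), a.natAbs + c.natAbs ≤ n → a * c = b ^ 2 →
      ∃ a' M, InG G M ∧ M *ᵥ ![1, 0, 0, 0, 0] = ![1, 0, 0, 0, 0] ∧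
        M *ᵥ ![p, 0, a, b, c] = ![p, 0, a', 0, 0] := by
  intro n
  induction n with
  | zero =>
    intro p a b c hn h
    have ha : a = 0 := by lia
    have hc : c = 0 := by lia
    subst ha; subst hc
    have hb : b = 0 := by simpa using h.symm
    subst hb
    exact ⟨0, 1, InG_one, by simp, by simp⟩
  | succ n ih =>
    have main : ∀ p a b c : ℤ, a.natAbs + c.natAbs ≤ n + 1 → a * c = b ^ 2 → a ≠ 0 → c ≠ 0 →
        a.natAbs ≤ c.natAbs →
        ∃ a' M, InG G M ∧ M *ᵥ ![1, 0, 0, 0, 0] = ![1, 0, 0, 0, 0] ∧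
        M *ᵥ ![p, 0, a, b, c] = ![p, 0, a', 0, 0] := by
      intro p a b c hn h ha hc hac
      obtain ⟨m, hm⟩ := near a b ha
      have hex : ∃ b' c' M, InG G M ∧ M *ᵥ ![1, 0, 0, 0, 0] = ![1, 0, 0, 0, 0] ∧
          M *ᵥ ![p, 0, a, b, c] = ![p, 0, a, b', c'] ∧ a * c' = b' ^ 2 ∧ |b'| = |b + m * a| := by
        rcases Int.even_or_odd' m with ⟨k, hk | hk⟩
        · refine ⟨_, _, Tm k, InG_T hA hB k, ?_, T_vec _ _ _ _ _ _, ?_, ?_⟩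
          · rw [T_vec]; simp
          · linear_combination h
          · rw [hk]
        · refine ⟨-a - b + 2 * (-k) * a, (a + 2 * b + c) + 4 * (-k) * (-a - b) + 4 * (-k) * (-k) * a, Tm (-k) * s2m, (InG_T hA hB (-k)).mul (InG_s2 hA hB), ?_, ?_, ?_, ?_⟩
          · rw [← mulVec_mulVec, s2_vec, T_vec]; simp
          · rw [← mulVec_mulVec, s2_vec, T_vec]
          · linear_combination h
          · rw [hk, ← abs_neg]; congr 1; ring
      obtain ⟨b', c', M, hM, hMe, hMv, hbc, hbb⟩ := hex
      rw [← hbb] at hm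
      have hlt : |c'| < |a| := by
        have h1 : |a| * |c'| = |b'| ^ 2 := by rw [← abs_mul, hbc, abs_pow]
        have h2 : 0 < |a| := abs_pos.2 ha
        have h3 := abs_nonneg b'
        nlinarith
      simp only [Int.abs_eq_natAbs] at hlt
      obtain ⟨a', N, hN, hNe, hNv⟩ := ih p a b' c' (by lia) hbc
      refine ⟨a', N * M, hN.mul hM, ?_, ?_⟩
      · rw [← mulVec_mulVec, hMe, hNe]
      · rw [← mulVec_mulVec, hMv, hNv]
    intro p a b c hn h
    by_cases hc : c = 0
    · subst hc
      have hb : b = 0 := by simpa using h.symm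
      subst hb
      exact ⟨a, 1, InG_one, by simp, by simp⟩
    by_cases ha : a = 0
    · subst ha
      have hb : b = 0 := by simpa using h.symm
      subst hb
      exact ⟨c, s1m, InG_s1 hA hB, s1_vec _ _ _ _ _, s1_vec _ _ _ _ _⟩
    rcases le_total a.natAbs c.natAbs with hac | hac
    · exact main p a b c hn h ha hc hac
    · obtain ⟨a', M, hM, hMe, hMv⟩ := main p c b a (by lia) (by linarith) hc ha hac
      refine ⟨a', M * s1m, hM.mul (InG_s1 hA hB), ?_, ?_⟩
      · rw [← mulVec_mulVec, s1_vec, hMe]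
      · rw [← mulVec_mulVec, s1_vec, hMv]

/-- Third reduction. -/
theorem stepC {G : Subgroup (GL (Fin 5) ℤ)} (hA : InG G Am) (hB : InG G Bm) :
    ∀ (n : ℕ) (p a : ℤ), p.natAbs + a.natAbs ≤ n → Good ![p, 0, a, 0, 0] →
      Rl G ![p, 0, a, 0, 0] ![1, 0, 0, 0, 0] := by
  intro n
  induction n with
  | zero =>
    intro p a hn hg
    obtain ⟨h1, p', q', a', b', c', h2⟩ := hg.iff
    have hp : p = 0 := by lia
    have ha : a = 0 := by lia
    subst hp; subst ha
    simp at h2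
  | succ n ih =>
    intro p a hn hg
    obtain ⟨h1, p', q', a', b', c', h2⟩ := hg.iff
    have hp : p ≠ 0 := by rintro rfl; lia
    by_cases ha : a = 0
    · subst ha
      have hu : IsUnit p := IsUnit.of_mul_eq_one q' (by linarith)
      rcases Int.isUnit_iff.1 hu with rfl | rfl
      · exact Rl.refl _
      · exact ⟨_, InG_neg hA hB, by decide +kernel⟩
    rcases lt_trichotomy p.natAbs a.natAbs with hlt | heq | hlt
    · obtain ⟨m, hm⟩ := near (2 * p) a (by lia)
      have hR : Rl G ![p, 0, a, 0, 0] ![p, 0, a + m * (2 * p), 0, 0] :=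
        ⟨_, InG_V hA hB (2 * m) 0 0 m (by ring), by
          rw [V_vec]; ext i; fin_cases i <;> simp <;> ring⟩
      rw [abs_mul] at hm
      simp only [abs_two, Int.abs_eq_natAbs] at hm
      exact hR.trans (ih _ _ (by lia) (hR.good hg))
    · have hu : IsUnit p := by
        have hd : p ∣ a := Int.natAbs_dvd_natAbs.1 (heq ▸ dvd_rfl)
        obtain ⟨k, rfl⟩ := hd
        exact IsUnit.of_mul_eq_one (q' - 2 * k * c') (by linarith)
      have hp1 := Int.isUnit_iff.1 hu
      have ha1 : a = 1 ∨ a = -1 := by lia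
      rcases hp1 with rfl | rfl <;> rcases ha1 with rfl | rfl
      · exact ⟨_, InG_base0 hA hB, by decide +kernel⟩
      · exact ⟨_, InG_base2 hA hB, by decide +kernel⟩
      · exact ⟨_, InG_base1 hA hB, by decide +kernel⟩
      · exact ⟨_, InG_base3 hA hB, by decide +kernel⟩
    · obtain ⟨m, hm⟩ := near (2 * a) p (by lia)
      have hR : Rl G ![p, 0, a, 0, 0] ![p + m * (2 * a), 0, a, 0, 0] :=
        ⟨_, InG_U hA hB m 0 m m (by ring), by
          rw [U_vec]; ext i; fin_cases i <;> simp; ring⟩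
      rw [abs_mul] at hm
      simp only [abs_two, Int.abs_eq_natAbs] at hm
      exact hR.trans (ih _ _ (by lia) (hR.good hg))

/-- Every good vector is equivalent to `e`. -/
theorem stepD {G : Subgroup (GL (Fin 5) ℤ)} (hA : InG G Am) (hB : InG G Bm)
    (v : Fin 5 → ℤ) (hv : Good v) : Rl G v ![1, 0, 0, 0, 0] := by
  rw [vec5 v] at hv ⊢
  obtain ⟨p, a, b, c, hR⟩ := stepA hA hB _ _ _ _ _ _ le_rfl hv
  have hg := hR.good hv
  obtain ⟨h1, -⟩ := hg.iff
  obtain ⟨a', M, hM, -, hMv⟩ := stepB hA hB _ p a b c le_rfl (by linarith)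
  have hR2 : Rl G ![p, 0, a, b, c] ![p, 0, a', 0, 0] := ⟨M, hM, hMv⟩
  exact (hR.trans hR2).trans (stepC hA hB _ _ _ le_rfl (hR2.good hg))


theorem Pres.mul {M N : M5} (h : Pres M) (k : Pres N) : Pres (M * N) := by
  intro v w
  rw [← mulVec_mulVec, ← mulVec_mulVec, h, k]

theorem entry (K : M5) (j : Fin 5) (i : Fin 5) : K i j = (K *ᵥ Pi.single j 1) i := by
  simp

theorem row1 {K : M5} (hK : Pres K) (he : K *ᵥ ![1, 0, 0, 0, 0] = ![1, 0, 0, 0, 0])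
    (p q a b c : ℤ) : ∃ p' a' b' c', K *ᵥ ![p, q, a, b, c] = ![p', q, a', b', c'] := by
  have h := hK ![1, 0, 0, 0, 0] ![p, q, a, b, c]
  rw [he, vec5 (K *ᵥ ![p, q, a, b, c]), bil_vec, bil_vec] at h
  refine ⟨(K *ᵥ ![p, q, a, b, c]) 0, (K *ᵥ ![p, q, a, b, c]) 2, (K *ᵥ ![p, q, a, b, c]) 3,
    (K *ᵥ ![p, q, a, b, c]) 4, ?_⟩
  have h' : (K *ᵥ ![p, q, a, b, c]) 1 = q := by linarith
  exact (vec5 _).trans (by rw [h'])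

theorem unit_cases {a c : ℤ} (h : a * c = 1) : (a = 1 ∧ c = 1) ∨ (a = -1 ∧ c = -1) :=
  Int.mul_eq_one_iff_eq_one_or_neg_one.1 h

theorem final_bound {K : M5} (hK : Pres K) (he : K *ᵥ ![1, 0, 0, 0, 0] = ![1, 0, 0, 0, 0])
    {p c : ℤ} (hx : K *ᵥ ![0, 0, 0, 0, 1] = ![p, 0, 0, 0, c])
    {p' a' b' c' : ℤ} (hx' : K *ᵥ ![0, 0, 1, 0, 0] = ![p', 0, a', b', c'])
    (hb' : b' = 0 ∨ b' = 1)
    {pf af : ℤ} (hf : K *ᵥ ![0, 1, 0, 0, 0] = ![pf, 1, af, 0, 0])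
    (haf : af = 0 ∨ af = 1) : ∀ i j, K i j ∈ Finset.Icc (-4 : ℤ) 4 := by
  obtain ⟨pz, az, bz, cz, hz⟩ := row1 hK he 0 0 0 1 0
  have h1 := hK ![0, 0, 0, 0, 1] ![0, 0, 1, 0, 0]
  have h2 := hK ![0, 0, 1, 0, 0] ![0, 0, 1, 0, 0]
  have h3 := hK ![0, 1, 0, 0, 0] ![0, 1, 0, 0, 0]
  have h4 := hK ![0, 0, 0, 1, 0] ![0, 0, 0, 0, 1]
  have h5 := hK ![0, 0, 0, 1, 0] ![0, 0, 0, 1, 0]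
  have h6 := hK ![0, 0, 0, 1, 0] ![0, 0, 1, 0, 0]
  have h7 := hK ![0, 1, 0, 0, 0] ![0, 0, 0, 0, 1]
  have h8 := hK ![0, 1, 0, 0, 0] ![0, 0, 1, 0, 0]
  have h9 := hK ![0, 1, 0, 0, 0] ![0, 0, 0, 1, 0]
  rw [hx, hx', bil_vec, bil_vec] at h1
  rw [hx', bil_vec, bil_vec] at h2
  rw [hf, bil_vec, bil_vec] at h3
  rw [hz, hx, bil_vec, bil_vec] at h4
  rw [hz, bil_vec, bil_vec] at h5
  rw [hz, hx', bil_vec, bil_vec] at h6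
  rw [hf, hx, bil_vec, bil_vec] at h7
  rw [hf, hx', bil_vec, bil_vec] at h8
  rw [hf, hz, bil_vec, bil_vec] at h9
  have hac : a' * c = 1 := by linarith
  have haz : az = 0 := by
    rcases unit_cases hac with ⟨rfl, rfl⟩ | ⟨rfl, rfl⟩ <;> linarith
  subst haz
  have hbz : bz * bz = 1 := by linarith
  have key : pf ∈ Finset.Icc (-4 : ℤ) 4 ∧ af ∈ Finset.Icc (-4 : ℤ) 4 ∧ p ∈ Finset.Icc (-4 : ℤ) 4 ∧
      c ∈ Finset.Icc (-4 : ℤ) 4 ∧ p' ∈ Finset.Icc (-4 : ℤ) 4 ∧ a' ∈ Finset.Icc (-4 : ℤ) 4 ∧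
      b' ∈ Finset.Icc (-4 : ℤ) 4 ∧ c' ∈ Finset.Icc (-4 : ℤ) 4 ∧ pz ∈ Finset.Icc (-4 : ℤ) 4 ∧
      bz ∈ Finset.Icc (-4 : ℤ) 4 ∧ cz ∈ Finset.Icc (-4 : ℤ) 4 := by
    simp only [Finset.mem_Icc]
    rcases unit_cases hac with ⟨rfl, rfl⟩ | ⟨rfl, rfl⟩ <;>
    rcases unit_cases hbz with ⟨rfl, -⟩ | ⟨rfl, -⟩ <;>
    rcases hb' with rfl | rfl <;> rcases haf with rfl | rfl <;> and_intros <;> lia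
  obtain ⟨k1, k2, k3, k4, k5, k6, k7, k8, k9, k10, k11⟩ := key
  have z0 : (0 : ℤ) ∈ Finset.Icc (-4 : ℤ) 4 := by decide
  have z1 : (1 : ℤ) ∈ Finset.Icc (-4 : ℤ) 4 := by decide
  intro i j
  rw [entry K j i]
  have s0 : (Pi.single 0 1 : Fin 5 → ℤ) = ![1, 0, 0, 0, 0] := by decide
  have s1 : (Pi.single 1 1 : Fin 5 → ℤ) = ![0, 1, 0, 0, 0] := by decide
  have s2 : (Pi.single 2 1 : Fin 5 → ℤ) = ![0, 0, 1, 0, 0] := by decide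
  have s3 : (Pi.single 3 1 : Fin 5 → ℤ) = ![0, 0, 0, 1, 0] := by decide
  have s4 : (Pi.single 4 1 : Fin 5 → ℤ) = ![0, 0, 0, 0, 1] := by decide
  have hj : j = 0 ∨ j = 1 ∨ j = 2 ∨ j = 3 ∨ j = 4 := by lia
  rcases hj with rfl | rfl | rfl | rfl | rfl
  · rw [s0, he]; fin_cases i <;> assumption
  · rw [s1, hf]; fin_cases i <;> assumption
  · rw [s2, hx']; fin_cases i <;> assumption
  · rw [s3, hz]; fin_cases i <;> assumption
  · rw [s4, hx]; fin_cases i <;> assumption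

theorem stab {G : Subgroup (GL (Fin 5) ℤ)} (hA : InG G Am) (hB : InG G Bm) {h : M5}
    (hh : Pres h) (he : h *ᵥ ![1, 0, 0, 0, 0] = ![1, 0, 0, 0, 0]) :
    ∃ M, InG G M ∧ ∀ i j, (M * h) i j ∈ Finset.Icc (-4 : ℤ) 4 := by
  -- normalise the image of x
  obtain ⟨p, a, b, c, hx⟩ := row1 hh he 0 0 0 0 1
  have h1 := hh ![0, 0, 0, 0, 1] ![0, 0, 0, 0, 1]
  rw [hx, bil_vec, bil_vec] at h1
  obtain ⟨c1, M1, hM1, hM1e, hM1v⟩ := stepB hA hB _ p a b c le_rfl (by linarith)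
  have hN1 := (InG_s1 hA hB).mul hM1
  set K1 : M5 := (s1m * M1) * h with hK1
  have pK1 : Pres K1 := hN1.2.mul hh
  have eK1 : K1 *ᵥ ![1, 0, 0, 0, 0] = ![1, 0, 0, 0, 0] := by
    rw [hK1, ← mulVec_mulVec, he, ← mulVec_mulVec, hM1e, s1_vec]
  have xK1 : K1 *ᵥ ![0, 0, 0, 0, 1] = ![p, 0, 0, 0, c1] := by
    rw [hK1, ← mulVec_mulVec, hx, ← mulVec_mulVec, hM1v, s1_vec]
  obtain ⟨p', a', b', c', hx'⟩ := row1 pK1 eK1 0 0 1 0 0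
  have h2 := pK1 ![0, 0, 0, 0, 1] ![0, 0, 1, 0, 0]
  rw [xK1, hx', bil_vec, bil_vec] at h2
  have hac : a' * c1 = 1 := by linarith
  obtain ⟨n, hn⟩ : ∃ n : ℤ, b' + 2 * n * a' = 0 ∨ b' + 2 * n * a' = 1 := by
    rcases unit_cases hac with ⟨rfl, -⟩ | ⟨rfl, -⟩
    · exact ⟨-(b' / 2), by lia⟩
    · exact ⟨b' / 2, by lia⟩
  have hN2 := InG_T hA hB n
  set K2 : M5 := Tm n * K1 with hK2
  have pK2 : Pres K2 := hN2.2.mul pK1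
  have eK2 : K2 *ᵥ ![1, 0, 0, 0, 0] = ![1, 0, 0, 0, 0] := by
    rw [hK2, ← mulVec_mulVec, eK1, T_vec]; simp
  have xK2 : K2 *ᵥ ![0, 0, 0, 0, 1] = ![p, 0, 0, 0, c1] := by
    rw [hK2, ← mulVec_mulVec, xK1, T_vec]; simp
  have x'K2 : K2 *ᵥ ![0, 0, 1, 0, 0] = ![p', 0, a', b' + 2 * n * a', c' + 4 * n * b' + 4 * n * n * a'] := by
    rw [hK2, ← mulVec_mulVec, hx', T_vec]
  obtain ⟨pf, af, bf, cf, hf⟩ := row1 pK2 eK2 0 1 0 0 0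
  obtain ⟨x, m, hm, hx0⟩ : ∃ x m : ℤ, x + -bf + -cf = 2 * m ∧ (af + x * 1 = 0 ∨ af + x * 1 = 1) := by
    rcases Int.even_or_odd' (-af + -bf + -cf) with ⟨m, hm | hm⟩
    · exact ⟨-af, m, hm, by lia⟩
    · exact ⟨1 - af, m + 1, by lia, by lia⟩
  have hN3 := InG_U hA hB x (-bf) (-cf) m hm
  refine ⟨Um x (-bf) (-cf) * (Tm n * (s1m * M1)), hN3.mul (hN2.mul hN1), ?_⟩
  have eqK : Um x (-bf) (-cf) * (Tm n * (s1m * M1)) * h = Um x (-bf) (-cf) * K2 := by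
    rw [hK2, hK1]; simp only [mul_assoc]
  rw [eqK]
  have e3 : (Um x (-bf) (-cf) * K2) *ᵥ ![1, 0, 0, 0, 0] = ![1, 0, 0, 0, 0] := by
    rw [← mulVec_mulVec, eK2, U_vec]; simp
  have x3 := U_vec x (-bf) (-cf) p 0 0 0 c1
  rw [← xK2, mulVec_mulVec] at x3
  have x'3 := U_vec x (-bf) (-cf) p' 0 a' (b' + 2 * n * a') (c' + 4 * n * b' + 4 * n * n * a')
  rw [← x'K2, mulVec_mulVec] at x'3
  have f3 := U_vec x (-bf) (-cf) pf 1 af bf cf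
  rw [← hf, mulVec_mulVec] at f3
  simp only [mul_zero, mul_one, add_zero, add_neg_cancel] at x3 x'3 f3 hx0
  exact final_bound (hN3.2.mul pK2) e3 x3 x'3 hn f3 hx0


/-- The Gram matrix of `Q` in the new coordinates. -/
def JJ : M5 :=
  !![0, -4, 0, 0, 0; -4, 0, 0, 0, 0; 0, 0, 0, 0, 8; 0, 0, 0, -16, 0; 0, 0, 8, 0, 0]

theorem JJ_eq : Smᵀ * matQ * Sm = JJ := by decide +kernel

theorem JJ_bil (v w : Fin 5 → ℤ) : v ⬝ᵥ (JJ *ᵥ w) = -4 * bil v w := by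
  rw [vec5 v, vec5 w, bil_vec]
  simp [JJ, Matrix.mulVec, dotProduct, Fin.sum_univ_succ]
  ring

theorem Pres.of_JJ {M : M5} (h : Mᵀ * JJ * M = JJ) : Pres M := by
  intro v w
  have h1 := JJ_bil (M *ᵥ v) (M *ᵥ w)
  have h2 : (M *ᵥ v) ⬝ᵥ (JJ *ᵥ (M *ᵥ w)) = v ⬝ᵥ (JJ *ᵥ w) := by
    conv_rhs => rw [← h]
    rw [← mulVec_mulVec, ← mulVec_mulVec, Matrix.dotProduct_mulVec v, Matrix.vecMul_transpose]
  rw [h2, JJ_bil] at h1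
  linarith

theorem div_col {v0 v1 v2 v3 v4 : ℤ}
    (h : v0 * (3 * v0 - 3 * v1 - v2 + 5 * v3 - 5 * v4) + v1 * (-3 * v0 + 3 * v1 - 3 * v2 - v3 + 5 * v4)
      + v2 * (-v0 - 3 * v1 + 3 * v2 - 3 * v3 - v4) + v3 * (5 * v0 - v1 - 3 * v2 + 3 * v3 - 3 * v4)
      + v4 * (-5 * v0 + 5 * v1 - v2 - 3 * v3 + 3 * v4) = 0) :
    4 ∣ -3 * v0 + 3 * v1 + v2 - v3 + v4 := by
  have h8 : 8 ∣ 3 * (-3 * v0 + 3 * v1 + v2 - v3 + v4) ^ 2 := by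
    refine ⟨(2 * v0 - v2 + v3) * (-v0 + 2 * v1 - v3 + v4)
      - 2 * (2 * v0 - 3 * v1 + v3 - v4) * (v0 - 2 * v1 - v4)
      - (2 * v0 - 3 * v1 + v3 - v4) * (-3 * v0 + 3 * v1 + v2 - v3 + v4)
      - (-3 * v0 + 3 * v1 + v2 - v3 + v4) * (v0 - 2 * v1 - v4), ?_⟩
    linear_combination h
  generalize -3 * v0 + 3 * v1 + v2 - v3 + v4 = β at h8
  have h2 : β % 4 = 0 ∨ β % 4 = 1 ∨ β % 4 = 2 ∨ β % 4 = 3 := by lia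
  obtain ⟨k, hk⟩ := h8
  have h3 := Int.emod_add_mul_ediv β 4
  generalize β / 4 = m at h3
  rcases h2 with h2 | h2 | h2 | h2
  · lia
  · rw [h2] at h3
    rw [← h3] at hk
    ring_nf at hk
    lia
  · rw [h2] at h3
    rw [← h3] at hk
    ring_nf at hk
    lia
  · rw [h2] at h3
    rw [← h3] at hk
    ring_nf at hk
    lia

theorem NS : Nm * Sm = (4 : ℤ) • (1 : M5) := by decide +kernel
theorem SN : Sm * Nm = (4 : ℤ) • (1 : M5) := by decide +kernel

theorem div_W {W : M5} (hW : Wᵀ * matQ * W = JJ) (j : Fin 5) (hj : JJ j j = 0) (i : Fin 5) :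
    4 ∣ (Nm * W) i j := by
  have h : (Wᵀ * matQ * W) j j = 0 := by rw [hW, hj]
  have hd : 4 ∣ -3 * W 0 j + 3 * W 1 j + W 2 j - W 3 j + W 4 j := by
    apply div_col
    rw [← h]
    simp [Matrix.mul_apply, matQ, Fin.sum_univ_succ]
    ring
  fin_cases i <;> simp [Matrix.mul_apply, Nm, Fin.sum_univ_succ] <;> lia

theorem transfer {g : GL (Fin 5) ℤ} (hg : g ∈ orthogonalSubgroup matQ) :
    ∃ g' : M5, (g : M5) * Sm = Sm * g' ∧ Pres g' := by
  have hg0 : (g : M5)ᵀ * matQ * (g : M5) = matQ := hg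
  have hW : ((g : M5) * Sm)ᵀ * matQ * ((g : M5) * Sm) = JJ := by
    rw [← JJ_eq, transpose_mul]
    conv_rhs => rw [← hg0]
    simp only [mul_assoc]
  have hdiv : ∀ i j, 4 ∣ (Nm * ((g : M5) * Sm)) i j := by
    intro i j
    by_cases hj : JJ j j = 0
    · exact div_W hW j hj i
    · have hj3 : j = 3 := by
        revert hj; revert j; decide +kernel
      subst hj3
      have h2 := div_W hW 2 (by decide +kernel) i
      have h4 := div_W hW 4 (by decide +kernel) i
      rw [← mul_assoc] at h2 h4 ⊢
      generalize Nm * (g : M5) = P at *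
      simp [Matrix.mul_apply, Sm, Fin.sum_univ_succ] at h2 h4 ⊢
      lia
  choose g' hg' using hdiv
  have hN : Nm * ((g : M5) * Sm) = (4 : ℤ) • (Matrix.of g' : M5) := by
    ext i j
    simp [hg']
  have hS : (g : M5) * Sm = Sm * Matrix.of g' := by
    have h4 : (4 : ℤ) • ((g : M5) * Sm) = (4 : ℤ) • (Sm * Matrix.of g') := by
      calc (4 : ℤ) • ((g : M5) * Sm) = (Sm * Nm) * ((g : M5) * Sm) := by
            rw [SN, smul_mul_assoc, one_mul]
        _ = Sm * (Nm * ((g : M5) * Sm)) := by rw [mul_assoc]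
        _ = _ := by rw [hN, mul_smul_comm]
    exact smul_right_injective M5 (by norm_num : (4 : ℤ) ≠ 0) h4
  refine ⟨Matrix.of g', hS, Pres.of_JJ ?_⟩
  rw [hS] at hW
  conv_lhs => rw [← JJ_eq]
  rw [← hW, transpose_mul]
  simp only [mul_assoc]

theorem S_cancel {u u' : M5} (h : u * Sm = u' * Sm) : u = u' := by
  have h4 : u * (Sm * Nm) = u' * (Sm * Nm) := by rw [← mul_assoc, h, mul_assoc]
  rw [SN, mul_smul_comm, mul_smul_comm, mul_one, mul_one] at h4
  exact smul_right_injective M5 (by norm_num : (4 : ℤ) ≠ 0) h4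

theorem reduce {G : Subgroup (GL (Fin 5) ℤ)} (hA : InG G Am) (hB : InG G Bm)
    {g : GL (Fin 5) ℤ} (hg : g ∈ orthogonalSubgroup matQ) :
    ∃ γ ∈ G, ∃ K : Fin 5 → Fin 5 → Finset.Icc (-4 : ℤ) 4,
      ((γ * g : GL (Fin 5) ℤ) : M5) * Sm = Sm * Matrix.of (fun i j => (K i j : ℤ)) := by
  obtain ⟨g', hS, hP⟩ := transfer hg
  have hgood : Good (g' *ᵥ ![1, 0, 0, 0, 0]) := by
    refine ⟨by rw [hP, bil_vec]; norm_num, g' *ᵥ ![0, 1, 0, 0, 0], by rw [hP, bil_vec]; norm_num⟩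
  obtain ⟨M, hM, hMv⟩ := stepD hA hB _ hgood
  rw [mulVec_mulVec] at hMv
  obtain ⟨N, hN, hb⟩ := stab hA hB (hM.2.mul hP) hMv
  obtain ⟨⟨γ, hγ, e⟩, -⟩ := hN.mul hM
  refine ⟨γ, hγ, fun i j => ⟨_, hb i j⟩, ?_⟩
  rw [Units.val_mul, mul_assoc, hS, ← mul_assoc, e, mul_assoc, mul_assoc]
  rfl

theorem finIdx {G : Subgroup (GL (Fin 5) ℤ)} (hA : InG G Am) (hB : InG G Bm)
    (hle : G ≤ orthogonalSubgroup matQ) :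
    (G.subgroupOf (orthogonalSubgroup matQ)).FiniteIndex := by
  have key : ∀ x : orthogonalSubgroup matQ ⧸ G.subgroupOf (orthogonalSubgroup matQ),
      ∃ K : Fin 5 → Fin 5 → Finset.Icc (-4 : ℤ) 4, ∃ u : orthogonalSubgroup matQ,
        x = QuotientGroup.mk (u⁻¹) ∧
        ((u : GL (Fin 5) ℤ) : M5) * Sm = Sm * Matrix.of (fun i j => (K i j : ℤ)) := by
    intro x
    obtain ⟨g, rfl⟩ := QuotientGroup.mk_surjective x
    obtain ⟨γ, hγ, K, hK⟩ := reduce hA hB ((orthogonalSubgroup matQ).inv_mem g.2)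
    have hm : γ * (g : GL (Fin 5) ℤ)⁻¹ ∈ orthogonalSubgroup matQ :=
      (orthogonalSubgroup matQ).mul_mem (hle hγ) ((orthogonalSubgroup matQ).inv_mem g.2)
    refine ⟨K, ⟨γ * (g : GL (Fin 5) ℤ)⁻¹, hm⟩, ?_, hK⟩
    rw [QuotientGroup.eq, Subgroup.mem_subgroupOf, Subgroup.coe_mul, Subgroup.coe_inv,
      Subgroup.coe_inv]
    have : (g : GL (Fin 5) ℤ)⁻¹ * (γ * (g : GL (Fin 5) ℤ)⁻¹)⁻¹ = γ⁻¹ := by group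
    exact this ▸ G.inv_mem hγ
  choose K u hu hK using key
  have hinj : Function.Injective K := by
    intro x y hxy
    have h1 := hK x
    rw [hxy, ← hK y] at h1
    have h2 : u x = u y := Subtype.ext (Units.ext (S_cancel h1))
    rw [hu x, hu y, h2]
  have : Finite (orthogonalSubgroup matQ ⧸ G.subgroupOf (orthogonalSubgroup matQ)) :=
    Finite.of_injective K hinj
  exact Subgroup.finiteIndex_of_finite_quotient


/-- Case 8 of Theorem 1.2: the hypergeometric group `Γ(f,g)` generated by the companion matrices `A`, `B`
of `f(x) = x^5 + x^3 - x^2 - 1` and `g(x) = x^5 + x^4 + x + 1`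
is an arithmetic subgroup of `O_Q(ℤ)`: it preserves `Q`, it is contained in `O_Q(ℤ)`,
and it has finite index in `O_Q(ℤ)`. -/
theorem hypergeometric_group_arithmetic
    (A B : GL (Fin 5) ℤ)
    (hA : (A : Matrix (Fin 5) (Fin 5) ℤ) = matA)
    (hB : (B : Matrix (Fin 5) (Fin 5) ℤ) = matB) :
    matAᵀ * matQ * matA = matQ ∧
    matBᵀ * matQ * matB = matQ ∧
    Subgroup.closure {A, B} ≤ orthogonalSubgroup matQ ∧
    ((Subgroup.closure {A, B}).subgroupOf (orthogonalSubgroup matQ)).FiniteIndex := by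
  have h1 : matAᵀ * matQ * matA = matQ := by decide +kernel
  have h2 : matBᵀ * matQ * matB = matQ := by decide +kernel
  have hle : Subgroup.closure {A, B} ≤ orthogonalSubgroup matQ := by
    rw [Subgroup.closure_le]
    rintro g (rfl | rfl)
    · change (g : Matrix (Fin 5) (Fin 5) ℤ)ᵀ * matQ * (g : Matrix (Fin 5) (Fin 5) ℤ) = matQ
      rw [hA]; exact h1
    · change (g : Matrix (Fin 5) (Fin 5) ℤ)ᵀ * matQ * (g : Matrix (Fin 5) (Fin 5) ℤ) = matQ
      rw [hB]; exact h2
  refine ⟨h1, h2, hle, finIdx ?_ ?_ hle⟩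
  · refine ⟨⟨A, Subgroup.subset_closure (by simp), ?_⟩, Pres.of_JJ (by decide +kernel)⟩
    rw [hA]; decide +kernel
  · refine ⟨⟨B, Subgroup.subset_closure (by simp), ?_⟩, Pres.of_JJ (by decide +kernel)⟩
    rw [hB]; decide +kernel
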